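/- Suppose the ring extension A|B admits a right D2 quasibase γ_j ∈ S, u_j ∈ T. View E = End(_B A) as a right A-module via (f·a)(x) = f(x)a and let Hom(E_A, A_A) denote the right A-linear additive maps E → A, a left B-module via postcomposition with left multiplication by B. Then the map Ψ : A⊗_B A → Hom(E_A, A_A) induced by Ψ(a⊗a′)(f) = a·f(a′) is a well-defined isomorphism of left B-modules; an inverse is given by F ↦ Σ_j F(γ_j)·u_j. -/

import Mathlib

noncomputable section

open TensorProduct

variable (A : Type*) [Ring A] (B : Subring A)

/-- The `B`-balancing relations in `A ⊗_ℤ A`, realizing `A ⊗_B A` as a quotient of the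
tensor product of abelian groups. -/
def relB : AddSubgroup (A ⊗[ℤ] A) :=
  AddSubgroup.closure {z | ∃ a a' b : A, b ∈ B ∧ z = (a * b) ⊗ₜ[ℤ] a' - a ⊗ₜ[ℤ] (b * a')}

/-- `A ⊗_B A`. -/
abbrev QB := (A ⊗[ℤ] A) ⧸ relB A B

/-- The canonical quotient map `A ⊗_ℤ A → A ⊗_B A`. -/
def mkB : A ⊗[ℤ] A →+ QB A B := QuotientAddGroup.mk' _

theorem lmul_aux (c : A) :
    relB A B ≤ (relB A B).comap (LinearMap.rTensor A (LinearMap.mulLeft ℤ c)).toAddMonoidHom := by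
  rw [relB, AddSubgroup.closure_le]
  rintro z ⟨a, a', b, hb, rfl⟩
  simp only [SetLike.mem_coe, AddSubgroup.mem_comap, LinearMap.toAddMonoidHom_coe, map_sub,
    LinearMap.rTensor_tmul, LinearMap.mulLeft_apply]
  rw [← mul_assoc]
  exact AddSubgroup.subset_closure ⟨c * a, a', b, hb, rfl⟩

theorem rmul_aux (c : A) :
    relB A B ≤ (relB A B).comap (LinearMap.lTensor A (LinearMap.mulRight ℤ c)).toAddMonoidHom := by
  rw [relB, AddSubgroup.closure_le]
  rintro z ⟨a, a', b, hb, rfl⟩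
  simp only [SetLike.mem_coe, AddSubgroup.mem_comap, LinearMap.toAddMonoidHom_coe, map_sub,
    LinearMap.lTensor_tmul, LinearMap.mulRight_apply]
  rw [mul_assoc]
  exact AddSubgroup.subset_closure ⟨a, a' * c, b, hb, rfl⟩

/-- The left `A`-action on `A ⊗_B A` through the left tensorand. -/
def lmulB (c : A) : QB A B →+ QB A B :=
  QuotientAddGroup.map _ _ (LinearMap.rTensor A (LinearMap.mulLeft ℤ c)).toAddMonoidHom
    (lmul_aux A B c)

/-- The right `A`-action on `A ⊗_B A` through the right tensorand. -/
def rmulB (c : A) : QB A B →+ QB A B :=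
  QuotientAddGroup.map _ _ (LinearMap.lTensor A (LinearMap.mulRight ℤ c)).toAddMonoidHom
    (rmul_aux A B c)

/-- `E = End(_B A)`: the left `B`-linear additive endomorphisms of `A`. -/
def Egrp : AddSubgroup (A →+ A) where
  carrier := {f | ∀ b ∈ B, ∀ a : A, f (b * a) = b * f a}
  add_mem' := by
    intro f g hf hg b hb a
    simp [hf b hb a, hg b hb a, mul_add]
  zero_mem' := by intro b hb a; simp
  neg_mem' := by
    intro f hf b hb a
    simp [hf b hb a]

/-- `S = End(_B A_B)`: the `B`-`B`-bilinear additive endomorphisms of `A`. -/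
def Sgrp : AddSubgroup (A →+ A) where
  carrier := {f | ∀ b ∈ B, ∀ a : A, f (b * a) = b * f a ∧ f (a * b) = f a * b}
  add_mem' := by
    intro f g hf hg b hb a
    exact ⟨by simp [(hf b hb a).1, (hg b hb a).1, mul_add],
      by simp [(hf b hb a).2, (hg b hb a).2, add_mul]⟩
  zero_mem' := by intro b hb a; simp
  neg_mem' := by
    intro f hf b hb a
    exact ⟨by simp [(hf b hb a).1], by simp [(hf b hb a).2]⟩

/-- `Hom(_B A ⊗_B A, _B A)`: additive maps `A ⊗_B A → A` which are left `B`-linear for the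
`B`-action through the left tensorand. -/
def HomBQ : AddSubgroup (QB A B →+ A) where
  carrier := {F | ∀ b ∈ B, ∀ q : QB A B, F (lmulB A B b q) = b * F q}
  add_mem' := by
    intro F G hF hG b hb q
    simp [hF b hb q, hG b hb q, mul_add]
  zero_mem' := by intro b hb q; simp
  neg_mem' := by
    intro F hF b hb q
    simp [hF b hb q]

/-- `Hom(E_A, A_A)`: additive maps `E → A` that are right `A`-linear for the right `A`-module
structure `(f · a)(x) = f(x) a` on `E` and right multiplication on `A`. -/
def HomEA : AddSubgroup (↥(Egrp A B) →+ A) where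
  carrier := {F | ∀ (f f' : ↥(Egrp A B)) (a : A),
    (∀ x : A, (f' : A →+ A) x = (f : A →+ A) x * a) → F f' = F f * a}
  add_mem' := by
    intro F G hF hG f f' a h
    simp [hF f f' a h, hG f f' a h, add_mul]
  zero_mem' := by intro f f' a h; simp
  neg_mem' := by
    intro F hF f f' a h
    simp [hF f f' a h]

/-- The inclusion `S ⊆ E`. -/
def StoE (f : ↥(Sgrp A B)) : ↥(Egrp A B) :=
  ⟨(f : A →+ A), fun b hb a => (f.2 b hb a).1⟩

theorem QB.induction_on {P : QB A B → Prop} (q : QB A B)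
    (tmul : ∀ a a' : A, P (mkB A B (a ⊗ₜ[ℤ] a'))) (add : ∀ p q, P p → P q → P (p + q)) : P q := by
  obtain ⟨t, rfl⟩ := QuotientAddGroup.mk'_surjective (relB A B) q
  change P (mkB A B t)
  induction t using TensorProduct.induction_on with
  | zero => simpa using tmul 0 0
  | tmul a a' => exact tmul a a'
  | add x y hx hy => rw [map_add]; exact add _ _ hx hy

theorem lmulB_mkB_tmul (c a a' : A) :
    lmulB A B c (mkB A B (a ⊗ₜ[ℤ] a')) = mkB A B ((c * a) ⊗ₜ[ℤ] a') := rfl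

/-- The additive map `A ⊗_B A → A` sending `a ⊗ a'` to `a f(a')`, for `f ∈ End(_B A)`. -/
def evalB (f : ↥(Egrp A B)) : QB A B →+ A :=
  QuotientAddGroup.lift (relB A B)
    (LinearMap.mul' ℤ A ∘ₗ LinearMap.lTensor A (f : A →+ A).toIntLinearMap).toAddMonoidHom <| by
    rw [relB, AddSubgroup.closure_le]
    rintro z ⟨a, a', b, hb, rfl⟩
    simp [AddMonoidHom.mem_ker, f.2 b hb a', mul_assoc]

theorem evalB_mkB_tmul (f : ↥(Egrp A B)) (a a' : A) :
    evalB A B f (mkB A B (a ⊗ₜ[ℤ] a')) = a * (f : A →+ A) a' := rfl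

theorem evalB_lmulB (f : ↥(Egrp A B)) (c : A) (q : QB A B) :
    evalB A B f (lmulB A B c q) = c * evalB A B f q := by
  induction q using QB.induction_on with
  | tmul a a' => rw [lmulB_mkB_tmul, evalB_mkB_tmul, evalB_mkB_tmul, mul_assoc]
  | add p q hp hq => simp only [map_add, hp, hq, mul_add]

theorem evalB_add (f g : ↥(Egrp A B)) (q : QB A B) :
    evalB A B (f + g) q = evalB A B f q + evalB A B g q := by
  induction q using QB.induction_on with
  | tmul a a' => simp [evalB_mkB_tmul, mul_add]
  | add p q hp hq => rw [map_add, map_add, map_add, hp, hq]; abel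

theorem evalB_eq_mul (f f' : ↥(Egrp A B)) (a : A)
    (h : ∀ x : A, (f' : A →+ A) x = (f : A →+ A) x * a) (q : QB A B) :
    evalB A B f' q = evalB A B f q * a := by
  induction q using QB.induction_on with
  | tmul c c' => rw [evalB_mkB_tmul, evalB_mkB_tmul, h, mul_assoc]
  | add p q hp hq => rw [map_add, map_add, hp, hq, add_mul]

/-- The canonical map `A ⊗_B A → Hom(E_A, A_A)`, `a ⊗ a' ↦ (f ↦ a f(a'))`. -/
def psiB : QB A B →+ ↥(HomEA A B) :=
  AddMonoidHom.mk'
    (fun q => ⟨AddMonoidHom.mk' (fun f => evalB A B f q) fun f g => evalB_add A B f g q,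
      fun f f' a h => evalB_eq_mul A B f f' a h q⟩)
    fun p q => Subtype.ext <| AddMonoidHom.ext fun f => map_add (evalB A B f) p q

theorem psiB_apply (q : QB A B) (f : ↥(Egrp A B)) :
    (psiB A B q : ↥(Egrp A B) →+ A) f = evalB A B f q := rfl

theorem lmulB_add (c d : A) (q : QB A B) :
    lmulB A B (c + d) q = lmulB A B c q + lmulB A B d q := by
  induction q using QB.induction_on with
  | tmul a a' => simp only [lmulB_mkB_tmul, add_mul, TensorProduct.add_tmul, map_add]
  | add p q hp hq => rw [map_add, map_add, map_add, hp, hq]; abel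

/-- The right action of `A` on `End(_B A)`, `(f · a)(x) = f(x) a`. -/
def Egrp.mulRight (f : ↥(Egrp A B)) (a : A) : ↥(Egrp A B) :=
  ⟨(AddMonoidHom.mulRight a).comp (f : A →+ A), fun b hb x => by
    simp [f.2 b hb x, mul_assoc]⟩

theorem HomEA.map_mulRight (F : ↥(HomEA A B)) (f : ↥(Egrp A B)) (a : A) :
    (F : ↥(Egrp A B) →+ A) (Egrp.mulRight A B f a) = (F : ↥(Egrp A B) →+ A) f * a :=
  F.2 f _ a fun _ => rfl

section Quasibase

variable {A B} {n : ℕ} {γ : Fin n → ↥(Sgrp A B)} {u : Fin n → QB A B}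

theorem sum_lmulB_evalB
    (hqb : ∀ a a' : A, mkB A B (a ⊗ₜ[ℤ] a') = ∑ j, lmulB A B (a * (γ j : A →+ A) a') (u j))
    (q : QB A B) :
    ∑ j, lmulB A B (evalB A B (StoE A B (γ j)) q) (u j) = q := by
  induction q using QB.induction_on with
  | tmul a a' => exact (hqb a a').symm
  | add p q hp hq => simp only [map_add, lmulB_add, Finset.sum_add_distrib, hp, hq]

theorem sum_mulRight_evalB
    (hqb : ∀ a a' : A, mkB A B (a ⊗ₜ[ℤ] a') = ∑ j, lmulB A B (a * (γ j : A →+ A) a') (u j))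
    (f : ↥(Egrp A B)) :
    ∑ j, Egrp.mulRight A B (StoE A B (γ j)) (evalB A B f (u j)) = f := by
  ext x
  have h := congrArg (evalB A B f) (hqb 1 x)
  simp only [evalB_mkB_tmul, one_mul, map_sum, evalB_lmulB] at h
  rw [h, AddSubgroup.val_finsetSum, AddMonoidHom.finsetSum_apply]
  rfl

theorem psiB_sum_lmulB
    (hqb : ∀ a a' : A, mkB A B (a ⊗ₜ[ℤ] a') = ∑ j, lmulB A B (a * (γ j : A →+ A) a') (u j))
    (F : ↥(HomEA A B)) :
    psiB A B (∑ j, lmulB A B ((F : ↥(Egrp A B) →+ A) (StoE A B (γ j))) (u j)) = F := by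
  refine Subtype.ext (AddMonoidHom.ext fun f => ?_)
  rw [psiB_apply, map_sum]
  conv_rhs => rw [← sum_mulRight_evalB hqb f, map_sum]
  simp only [evalB_lmulB, HomEA.map_mulRight]

end Quasibase

/-- given a right D2 quasibase `γ_j ∈ S`, `u_j ∈ T`, the map
`Ψ : A ⊗_B A → Hom(E_A, A_A)` induced by `Ψ(a ⊗ a')(f) = a f(a')` is a well-defined
isomorphism of left `B`-modules, with inverse `F ↦ ∑_j F(γ_j) · u_j`. -/
theorem statement3 (n : ℕ) (γ : Fin n → ↥(Sgrp A B)) (u : Fin n → QB A B)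
    (hu : ∀ j, ∀ b ∈ B, lmulB A B b (u j) = rmulB A B b (u j))
    (hqb : ∀ a a' : A,
      mkB A B (a ⊗ₜ[ℤ] a') = ∑ j, lmulB A B (a * (γ j : A →+ A) a') (u j)) :
    ∃ Ψ : QB A B →+ ↥(HomEA A B),
      (∀ (a a' : A) (f : ↥(Egrp A B)),
        ((Ψ (mkB A B (a ⊗ₜ[ℤ] a')) : ↥(Egrp A B) →+ A)) f = a * (f : A →+ A) a') ∧
      (∀ b ∈ B, ∀ (q : QB A B) (f : ↥(Egrp A B)),
        ((Ψ (lmulB A B b q) : ↥(Egrp A B) →+ A)) f = b * ((Ψ q : ↥(Egrp A B) →+ A)) f) ∧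
      Function.Bijective Ψ ∧
      (∀ F : ↥(HomEA A B),
        Ψ (∑ j, lmulB A B ((F : ↥(Egrp A B) →+ A) (StoE A B (γ j))) (u j)) = F) := by
  exact ⟨psiB A B, fun a a' f => evalB_mkB_tmul A B f a a',
    fun b _ q f => evalB_lmulB A B f b q,
    ⟨Function.LeftInverse.injective (g := fun F : ↥(HomEA A B) =>
        ∑ j, lmulB A B ((F : ↥(Egrp A B) →+ A) (StoE A B (γ j))) (u j)) (sum_lmulB_evalB hqb),
      fun F => ⟨_, psiB_sum_lmulB hqb F⟩⟩,
    psiB_sum_lmulB hqb⟩
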